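/- Let 0 < α₁ < α₂. There exists κ₂* > 0 such that for every κ₂ ∈ (0, κ₂*], every (a₁,a₂) ∈ ℝ², and every κ₁ ≥ 0 the following holds. With σ = (α₁+α₂)/(2α₂), δ = κ₂/(8α₁), β = (2+σ)δ, C₁ = 2, C₂ = 1, set φ₁(x,y) = C₁(5|x|^β − y²|x|^{β+1}), φ₂(x,y) = C₂(|x|^{2δ}+|y|^{2δ})/|y|^{2σδ}, U₁ = {x < −2, |y| < 2|x|^{−1/2}}, U₂ = {x < −2, |x|^{−1/2} < |y| < 2}. Let f(t) = exp(−1/(1−(2t−1)²)) for t ∈ [0,1] and f(t) = 0 otherwise, g(t) = (∫_ℝ f)^{−1}·∫_{−∞}^t f(s) ds, and ρ_{1,2}(x,y) = g(|x|^{1/2}|y| − 1). Then the function φ_{1,2} on U₁ ∪ U₂, defined as φ₁ where |x|^{1/2}|y| ≤ 1 and as ρ_{1,2}φ₂ + (1−ρ_{1,2})φ₁ where |x|^{1/2}|y| > 1, is a Lyapunov function for L on U₁ ∪ U₂. -/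

import Mathlib

noncomputable def Lop (a₁ a₂ α₁ α₂ κ₁ κ₂ : ℝ) (Φ : ℝ × ℝ → ℝ) (p : ℝ × ℝ) : ℝ :=
  (a₁ * p.1 - α₁ * p.1 ^ 2 + p.2 ^ 2) * deriv (fun t => Φ (t, p.2)) p.1
    + (a₂ * p.2 - α₂ * p.1 * p.2) * deriv (fun t => Φ (p.1, t)) p.2
    + κ₁ * deriv (deriv (fun t => Φ (t, p.2))) p.1
    + κ₂ * deriv (deriv (fun t => Φ (p.1, t))) p.2

/-- `φ` is a Lyapunov function for the operator `L` (with the given parameters) on `U`: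
(I) `φ` is `C^∞` on `U`; (II) `φ z → ∞` as `|z| → ∞`, `z ∈ U`;
(III) there are `C, D > 0` with `Lφ ≤ -C•φ + D` on `U`. -/
def IsLyapunovOn (a₁ a₂ α₁ α₂ κ₁ κ₂ : ℝ) (φ : ℝ × ℝ → ℝ) (U : Set (ℝ × ℝ)) : Prop :=
  ContDiffOn ℝ (⊤ : ℕ∞) φ U ∧
    (∀ M : ℝ, ∃ R : ℝ, ∀ z ∈ U, R < ‖z‖ → M < φ z) ∧
    (∃ C > (0:ℝ), ∃ D > (0:ℝ), ∀ z ∈ U, Lop a₁ a₂ α₁ α₂ κ₁ κ₂ φ z ≤ -C * φ z + D)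
noncomputable def phi1 (β : ℝ) (p : ℝ × ℝ) : ℝ :=
  2 * (5 * |p.1| ^ β - p.2 ^ 2 * |p.1| ^ (β + 1))

def U1 : Set (ℝ × ℝ) := {p : ℝ × ℝ | p.1 < -2 ∧ |p.2| < 2 * |p.1| ^ (-(1:ℝ)/2)}

noncomputable def phi2 (σ δ : ℝ) (p : ℝ × ℝ) : ℝ :=
  1 * ((|p.1| ^ (2 * δ) + |p.2| ^ (2 * δ)) / |p.2| ^ (2 * σ * δ))

def U2 : Set (ℝ × ℝ) := {p : ℝ × ℝ | p.1 < -2 ∧ |p.1| ^ (-(1:ℝ)/2) < |p.2| ∧ |p.2| < 2}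

/-- The bump function `f(t) = exp(-1/(1-(2t-1)²))` on `(0,1)` (which is its value on
`[0,1]` in the limiting sense) and `0` elsewhere. -/
noncomputable def fb (t : ℝ) : ℝ :=
  if t ∈ Set.Ioo (0:ℝ) 1 then Real.exp (-1 / (1 - (2 * t - 1) ^ 2)) else 0

/-- `g(t) = ‖f‖₁⁻¹ ∫_{-∞}^t f(s) ds`. -/
noncomputable def gb (t : ℝ) : ℝ := (∫ s, fb s)⁻¹ * ∫ s in Set.Iic t, fb s

noncomputable def rho12 (p : ℝ × ℝ) : ℝ := gb (|p.1| ^ ((1:ℝ)/2) * |p.2| - 1)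

/-- The patched function `φ_{1,2}`. -/
noncomputable def phi12 (σ δ β : ℝ) (p : ℝ × ℝ) : ℝ :=
  if |p.1| ^ ((1:ℝ)/2) * |p.2| ≤ 1 then phi1 β p
  else rho12 p * phi2 σ δ p + (1 - rho12 p) * phi1 β p

open Filter Topology

def J2 (f : ℝ → ℝ) (x a b : ℝ) : Prop :=
  ∃ f' : ℝ → ℝ, (∀ᶠ t in 𝓝 x, HasDerivAt f (f' t) t) ∧ f' x = a ∧ HasDerivAt f' b x

lemma J2.deriv1 {f : ℝ → ℝ} {x a b : ℝ} (h : J2 f x a b) : deriv f x = a := by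
  obtain ⟨f', h1, h2, h3⟩ := h
  rw [h1.self_of_nhds.deriv, h2]

lemma J2.deriv2 {f : ℝ → ℝ} {x a b : ℝ} (h : J2 f x a b) : deriv (deriv f) x = b := by
  obtain ⟨f', h1, h2, h3⟩ := h
  have : deriv f =ᶠ[𝓝 x] f' := h1.mono fun t ht => ht.deriv
  rw [this.deriv_eq, h3.deriv]

lemma J2.congr {f g : ℝ → ℝ} {x a b : ℝ} (h : J2 f x a b) (hg : g =ᶠ[𝓝 x] f) : J2 g x a b := by
  obtain ⟨f', h1, h2, h3⟩ := h
  refine ⟨f', ?_, h2, h3⟩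
  filter_upwards [h1, hg.eventuallyEq_nhds] with t ht hgt
  exact ht.congr_of_eventuallyEq hgt

lemma J2.cast {f : ℝ → ℝ} {x a b a' b' : ℝ} (h : J2 f x a b) (ha : a' = a) (hb : b' = b) :
    J2 f x a' b' := by subst ha hb; exact h

lemma J2.const (c x : ℝ) : J2 (fun _ => c) x 0 0 :=
  ⟨fun _ => 0, Eventually.of_forall fun t => hasDerivAt_const t c, rfl, hasDerivAt_const x 0⟩

lemma J2.add {f g : ℝ → ℝ} {x a b c d : ℝ} (hf : J2 f x a b) (hg : J2 g x c d) :
    J2 (fun t => f t + g t) x (a + c) (b + d) := by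
  obtain ⟨f', h1, h2, h3⟩ := hf
  obtain ⟨g', k1, k2, k3⟩ := hg
  refine ⟨fun t => f' t + g' t, ?_, by simp [h2, k2], h3.add k3⟩
  filter_upwards [h1, k1] with t ht kt
  exact ht.add kt

lemma J2.mul {f g : ℝ → ℝ} {x a b c d : ℝ} (hf : J2 f x a b) (hg : J2 g x c d) :
    J2 (fun t => f t * g t) x (a * g x + f x * c) (b * g x + 2 * a * c + f x * d) := by
  obtain ⟨f', h1, h2, h3⟩ := hf
  obtain ⟨g', k1, k2, k3⟩ := hg
  refine ⟨fun t => f' t * g t + f t * g' t, ?_, by simp [h2, k2], ?_⟩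
  · filter_upwards [h1, k1] with t ht kt
    exact ht.mul kt
  · have := (h3.mul k1.self_of_nhds).add (h1.self_of_nhds.mul k3)
    refine this.congr_deriv ?_
    rw [h2, k2]; ring

lemma J2.cmul {f : ℝ → ℝ} {x a b : ℝ} (c : ℝ) (hf : J2 f x a b) :
    J2 (fun t => c * f t) x (c * a) (c * b) :=
  ((J2.const c x).mul hf).cast (by ring) (by ring)

lemma J2.mulc {f : ℝ → ℝ} {x a b : ℝ} (c : ℝ) (hf : J2 f x a b) :
    J2 (fun t => f t * c) x (a * c) (b * c) :=
  (hf.mul (J2.const c x)).cast (by ring) (by ring)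

lemma J2.sub {f g : ℝ → ℝ} {x a b c d : ℝ} (hf : J2 f x a b) (hg : J2 g x c d) :
    J2 (fun t => f t - g t) x (a - c) (b - d) := by
  have := (hf.add (hg.cmul (-1)))
  refine (this.cast (a' := a - c) (b' := b - d) (by ring) (by ring)).congr ?_
  exact Eventually.of_forall fun t => by simp; ring

lemma J2.comp {f g : ℝ → ℝ} {x a b c d : ℝ} (hg : J2 g (f x) c d) (hf : J2 f x a b) :
    J2 (fun t => g (f t)) x (c * a) (d * a ^ 2 + c * b) := by
  obtain ⟨f', h1, h2, h3⟩ := hf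
  obtain ⟨g', k1, k2, k3⟩ := hg
  refine ⟨fun t => g' (f t) * f' t, ?_, by simp [h2, k2], ?_⟩
  · have := h1.self_of_nhds.continuousAt.eventually k1
    filter_upwards [h1, this] with t ht kt
    exact kt.comp t ht
  · have := (k3.comp x h1.self_of_nhds).mul h3
    refine this.congr_deriv ?_
    simp only [Function.comp, h2, k2]; ring

lemma hda_abs_rpow {t : ℝ} (p : ℝ) (ht : t ≠ 0) :
    HasDerivAt (fun t : ℝ => |t| ^ p) (p * |t| ^ p / t) t := by
  rcases lt_or_gt_of_ne ht with h | h
  · have h1 := (hasDerivAt_abs_neg h).rpow_const (p := p) (Or.inl (abs_ne_zero.2 ht))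
    refine h1.congr_deriv ?_
    rw [Real.rpow_sub_one (abs_ne_zero.2 ht), abs_of_neg h]
    field_simp
  · have h1 := (hasDerivAt_abs_pos h).rpow_const (p := p) (Or.inl (abs_ne_zero.2 ht))
    refine h1.congr_deriv ?_
    rw [Real.rpow_sub_one (abs_ne_zero.2 ht), abs_of_pos h]
    field_simp

lemma J2.abs_rpow {t : ℝ} (p : ℝ) (ht : t ≠ 0) :
    J2 (fun t : ℝ => |t| ^ p) t (p * |t| ^ p / t) (p * (p - 1) * |t| ^ p / t ^ 2) := by
  refine ⟨fun t => p * |t| ^ p / t, ?_, rfl, ?_⟩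
  · filter_upwards [eventually_ne_nhds ht] with u hu using hda_abs_rpow p hu
  · have := ((hda_abs_rpow p ht).const_mul p).div (hasDerivAt_id t) ht
    refine this.congr_deriv ?_
    simp only [id]
    field_simp

lemma J2.abs {t : ℝ} (ht : t ≠ 0) : J2 (fun t : ℝ => |t|) t (|t| / t) 0 := by
  refine ((J2.abs_rpow 1 ht).cast (by simp) (by simp)).congr ?_
  exact Eventually.of_forall fun t => by simp

lemma J2.sq (t : ℝ) : J2 (fun t : ℝ => t ^ 2) t (2 * t) 2 := by
  refine ⟨fun t => 2 * t, Eventually.of_forall fun u => ?_, rfl, ?_⟩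
  · simpa using hasDerivAt_pow 2 u
  · simpa using (hasDerivAt_id t).const_mul (2:ℝ)

/- bump -/
lemma fb_eq (t : ℝ) : fb t = expNegInvGlue (1 - (2 * t - 1) ^ 2) := by
  unfold fb expNegInvGlue
  by_cases h : t ∈ Set.Ioo (0:ℝ) 1
  · have : 0 < 1 - (2 * t - 1) ^ 2 := by nlinarith [h.1, h.2, mul_pos h.1 (sub_pos.2 h.2)]
    rw [if_pos h, if_neg (not_le.2 this)]
    congr 1; rw [neg_div, one_div]
  · rw [if_neg h, if_pos]
    by_contra hc
    push Not at hc
    apply h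
    constructor <;> nlinarith

lemma fb_contDiff : ContDiff ℝ (⊤ : ℕ∞) fb := by
  have : fb = fun t => expNegInvGlue (1 - (2 * t - 1) ^ 2) := funext fb_eq
  rw [this]
  exact expNegInvGlue.contDiff.comp (by fun_prop)

lemma fb_nonneg (t : ℝ) : 0 ≤ fb t := by rw [fb_eq]; exact expNegInvGlue.nonneg _

lemma fb_zero {t : ℝ} (h : t ∉ Set.Ioo (0:ℝ) 1) : fb t = 0 := if_neg h

lemma fb_le_one (t : ℝ) : fb t ≤ 1 := by
  unfold fb
  split_ifs with h
  · have : 0 < 1 - (2 * t - 1) ^ 2 := by nlinarith [h.1, h.2, mul_pos h.1 (sub_pos.2 h.2)]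
    rw [Real.exp_le_one_iff]
    exact div_nonpos_of_nonpos_of_nonneg (by norm_num) this.le
  · norm_num

lemma fb_supp : HasCompactSupport fb :=
  HasCompactSupport.intro (isCompact_Icc (a := (0:ℝ)) (b := 1)) fun t ht =>
    fb_zero fun h => ht ⟨h.1.le, h.2.le⟩

lemma fb_integrable : MeasureTheory.Integrable fb :=
  fb_contDiff.continuous.integrable_of_hasCompactSupport fb_supp

lemma fb_int_pos : 0 < ∫ s, fb s := by
  refine fb_contDiff.continuous.integral_pos_of_hasCompactSupport_nonneg_nonzero fb_supp
    fb_nonneg (x := 1/2) ?_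
  unfold fb
  rw [if_pos (by constructor <;> norm_num)]
  exact (Real.exp_pos _).ne'

lemma gb_hasDerivAt (t : ℝ) : HasDerivAt gb ((∫ s, fb s)⁻¹ * fb t) t := by
  unfold gb
  apply HasDerivAt.const_mul
  have h1 : (fun t => ∫ s in Set.Iic t, fb s) =
      fun t => (∫ s in Set.Iic 0, fb s) + ∫ s in (0:ℝ)..t, fb s := by
    funext u
    rw [← intervalIntegral.integral_Iic_sub_Iic fb_integrable.integrableOn
      fb_integrable.integrableOn]
    ring
  rw [h1]
  apply HasDerivAt.const_add
  exact intervalIntegral.integral_hasDerivAt_right (fb_integrable.intervalIntegrable)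
    (fb_contDiff.continuous.stronglyMeasurableAtFilter _ _) fb_contDiff.continuous.continuousAt

lemma gb_contDiff : ContDiff ℝ (⊤ : ℕ∞) gb := by
  rw [contDiff_infty_iff_deriv]
  refine ⟨fun t => (gb_hasDerivAt t).differentiableAt, ?_⟩
  have : deriv gb = fun t => (∫ s, fb s)⁻¹ * fb t := funext fun t => (gb_hasDerivAt t).deriv
  rw [this]
  exact contDiff_const.mul fb_contDiff

lemma gb_J2 (t : ℝ) : J2 gb t ((∫ s, fb s)⁻¹ * fb t) ((∫ s, fb s)⁻¹ * deriv fb t) := by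
  refine ⟨fun t => (∫ s, fb s)⁻¹ * fb t, Eventually.of_forall gb_hasDerivAt, rfl, ?_⟩
  exact ((fb_contDiff.differentiable (by simp)).differentiableAt.hasDerivAt).const_mul _

lemma gb_zero {t : ℝ} (h : t ≤ 0) : gb t = 0 := by
  unfold gb
  rw [MeasureTheory.setIntegral_eq_zero_of_forall_eq_zero, mul_zero]
  intro s hs
  exact fb_zero fun k => absurd k.1 (not_lt.2 (le_trans hs h))

lemma gb_one {t : ℝ} (h : 1 ≤ t) : gb t = 1 := by
  unfold gb
  rw [MeasureTheory.setIntegral_eq_integral_of_forall_compl_eq_zero,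
    inv_mul_cancel₀ fb_int_pos.ne']
  intro s hs
  simp only [Set.mem_Iic, not_le] at hs
  exact fb_zero fun k => absurd k.2 (not_lt.2 (by linarith))

lemma gb_mono : Monotone gb :=
  monotone_of_deriv_nonneg (fun t => (gb_hasDerivAt t).differentiableAt) fun t => by
    rw [(gb_hasDerivAt t).deriv]
    exact mul_nonneg (inv_nonneg.2 fb_int_pos.le) (fb_nonneg t)

lemma gb_nonneg (t : ℝ) : 0 ≤ gb t := by
  rcases le_total t 0 with h | h
  · rw [gb_zero h]
  · rw [← gb_zero le_rfl]; exact gb_mono h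

lemma gb_le_one (t : ℝ) : gb t ≤ 1 := by
  rcases le_total 1 t with h | h
  · rw [gb_one h]
  · rw [← gb_one le_rfl]; exact gb_mono h

lemma deriv_fb_zero {t : ℝ} (h : t ∉ Set.Ioo (0:ℝ) 1) : deriv fb t = 0 := by
  apply IsLocalMin.deriv_eq_zero
  apply Eventually.of_forall
  intro u
  rw [fb_zero h]; exact fb_nonneg u

lemma deriv_fb {t : ℝ} (h : t ∈ Set.Ioo (0:ℝ) 1) :
    deriv fb t = fb t * ((4 - 8 * t) / (1 - (2 * t - 1) ^ 2) ^ 2) := by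
  have hw : 0 < 1 - (2 * t - 1) ^ 2 := by nlinarith [h.1, h.2, mul_pos h.1 (sub_pos.2 h.2)]
  have e : fb =ᶠ[𝓝 t] fun t => Real.exp (-1 / (1 - (2 * t - 1) ^ 2)) := by
    filter_upwards [isOpen_Ioo.mem_nhds h] with u hu
    exact if_pos hu
  rw [e.deriv_eq, e.self_of_nhds]
  have hd : HasDerivAt (fun t : ℝ => 1 - (2 * t - 1) ^ 2) (4 - 8 * t) t := by
    have := ((((hasDerivAt_id t).const_mul 2).sub_const 1).pow 2).const_sub 1
    refine this.congr_deriv ?_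
    simp; ring
  have := ((hasDerivAt_const t (-1:ℝ)).div hd hw.ne').exp
  refine this.deriv.trans ?_
  simp

lemma deriv_fb_bound (ε : ℝ) (hε : 0 < ε) : ∃ M > 0, ∀ t, |deriv fb t| ≤ ε + M * fb t := by
  have hη : 0 < ε / 24 := by positivity
  refine ⟨4 / (ε / 24) ^ 2, by positivity, fun t => ?_⟩
  by_cases h : t ∈ Set.Ioo (0:ℝ) 1
  swap
  · rw [deriv_fb_zero h, fb_zero h]; simp [hε.le]
  have hw : 0 < 1 - (2 * t - 1) ^ 2 := by nlinarith [h.1, h.2, mul_pos h.1 (sub_pos.2 h.2)]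
  have hf := fb_nonneg t
  rw [deriv_fb h, abs_mul, abs_of_nonneg hf, abs_div, abs_of_pos (pow_pos hw 2)]
  have h4 : |4 - 8 * t| ≤ 4 := by rw [abs_le]; constructor <;> linarith [h.1, h.2]
  set w := 1 - (2 * t - 1) ^ 2 with hwd
  have hb : fb t * (|4 - 8 * t| / w ^ 2) ≤ fb t * (4 / w ^ 2) := by gcongr
  refine hb.trans ?_
  rcases le_total (ε / 24) w with k | k
  · have : fb t * (4 / w ^ 2) ≤ fb t * (4 / (ε / 24) ^ 2) := by gcongr
    linarith
  · have hft : fb t = (Real.exp (1 / w))⁻¹ := by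
      unfold fb
      rw [if_pos h, ← Real.exp_neg, neg_div]
    have he : (1 / w) ^ 3 / 6 ≤ Real.exp (1 / w) := by
      have := Real.pow_div_factorial_le_exp (1 / w) (by positivity) 3
      simpa [Nat.factorial] using this
    have h6 : fb t ≤ 6 * w ^ 3 := by
      rw [hft]
      rw [inv_le_comm₀ (Real.exp_pos _) (by positivity)]
      refine le_trans (le_of_eq ?_) he
      field_simp
    have : fb t * (4 / w ^ 2) ≤ 6 * w ^ 3 * (4 / w ^ 2) := by gcongr
    have e2 : 6 * w ^ 3 * (4 / w ^ 2) = 24 * w := by field_simp; norm_num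
    have : 0 ≤ 4 / (ε / 24) ^ 2 * fb t := by positivity
    linarith

noncomputable def L1e (a₁ a₂ α₁ α₂ κ₁ κ₂ β A X z : ℝ) : ℝ :=
  2 * A * ((5 * β - (β + 1) * (z * X)) * (a₁ + α₁ * X - z / X) - 2 * (z * X) * (a₂ + α₂ * X)
    + κ₁ * (5 * β * (β - 1) - (z * X) * ((β + 1) * β)) / X ^ 2 - 2 * κ₂ * X)

noncomputable def L2e (a₁ a₂ α₁ α₂ κ₁ κ₂ σ δ τ P Q X z : ℝ) : ℝ :=
  P * (2 * δ * (a₁ + α₁ * X - z / X) - 2 * σ * δ * (a₂ + α₂ * X)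
    + κ₁ * (2 * δ * (2 * δ - 1)) / X ^ 2 + κ₂ * (2 * σ * δ * (2 * σ * δ + 1)) / z)
  + Q * (τ * (a₂ + α₂ * X) + κ₂ * (τ * (τ - 1)) / z)

noncomputable def Te (a₁ a₂ α₁ α₂ κ₁ κ₂ σ δ τ β A P Q G1 G2 X z s : ℝ) : ℝ :=
  (P + Q - 2 * A * (5 - s ^ 2)) *
    (G1 * (s / 2) * (a₁ + α₁ * X - z / X) + G1 * s * (a₂ + α₂ * X)
      + κ₁ * (G2 * s ^ 2 - G1 * s) / (4 * X ^ 2) + κ₂ * G2 * X)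
  + κ₁ * G1 * (s / X ^ 2) * (2 * δ * P - 10 * β * A + 2 * (β + 1) * s ^ 2 * A)
  + 2 * κ₂ * G1 * (X / s) * (-(2 * σ * δ) * P + τ * Q + 4 * s ^ 2 * A)

lemma L1_bound (a₁ a₂ α₁ α₂ κ₁ κ₂ β : ℝ) (hα₁ : 0 < α₁) (hα₂ : 0 < α₂) (hκ₁ : 0 ≤ κ₁)
    (hβ : 0 ≤ β) (A X z : ℝ) (hA : 0 < A) (hX : 2 < X) (hz : 0 ≤ z) (hzX : z * X ≤ 4) :
    L1e a₁ a₂ α₁ α₂ κ₁ κ₂ β A X z + 2 * A * (5 - z * X) ≤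
      -(2 * (2 * κ₂ - 5 * β * α₁)) * (A * X)
        + 2 * ((5 * β + 4 * (β + 1)) * (|a₁| + 1) + 8 * |a₂| + 5 * κ₁ * β ^ 2 + 5) * A := by
  unfold L1e
  have hX0 : 0 < X := by linarith
  have hw0 : 0 ≤ z * X := by positivity
  have he0 : 0 ≤ z / X := by positivity
  have he1 : z / X ≤ 1 := by
    rw [div_le_one hX0]; nlinarith
  set w := z * X with hw
  set e := z / X with he
  have h1 : (5 * β - (β + 1) * w) * (a₁ - e) ≤ (5 * β + 4 * (β + 1)) * (|a₁| + 1) := by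
    refine (le_abs_self _).trans ?_
    rw [abs_mul]
    have t1 : |5 * β - (β + 1) * w| ≤ 5 * β + 4 * (β + 1) := by
      rw [abs_le]; constructor <;> nlinarith
    have t2 : |a₁ - e| ≤ |a₁| + 1 := by
      refine (abs_sub _ _).trans ?_
      rw [abs_of_nonneg he0]; linarith
    exact mul_le_mul t1 t2 (abs_nonneg _) (by positivity)
  have h2 : -(2 * w * a₂) ≤ 8 * |a₂| := by
    nlinarith [neg_abs_le a₂, abs_nonneg a₂]
  have h3 : κ₁ * (5 * β * (β - 1) - w * ((β + 1) * β)) / X ^ 2 ≤ 5 * κ₁ * β ^ 2 := by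
    rw [div_le_iff₀ (by positivity)]
    have t1 : 5 * β * (β - 1) - w * ((β + 1) * β) ≤ 5 * β ^ 2 := by
      have : 0 ≤ w * ((β + 1) * β) := by positivity
      nlinarith
    have t2 : (1:ℝ) ≤ X ^ 2 := by nlinarith
    calc κ₁ * (5 * β * (β - 1) - w * ((β + 1) * β)) ≤ κ₁ * (5 * β ^ 2) := by gcongr
      _ = 5 * κ₁ * β ^ 2 * 1 := by ring
      _ ≤ _ := by gcongr
  have h4 : 0 ≤ (β + 1) * w * α₁ * X := by positivity
  have h5 : 0 ≤ 2 * w * α₂ * X := by positivity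
  have key : ((5 * β - (β + 1) * w) * (a₁ + α₁ * X - e) - 2 * w * (a₂ + α₂ * X)
    + κ₁ * (5 * β * (β - 1) - w * ((β + 1) * β)) / X ^ 2 - 2 * κ₂ * X) + (5 - w) ≤
     -(2 * κ₂ - 5 * β * α₁) * X + ((5 * β + 4 * (β + 1)) * (|a₁| + 1) + 8 * |a₂|
       + 5 * κ₁ * β ^ 2 + 5) := by
    linear_combination h1 + h2 + h3 + h4 + h5 + hw0
  have := mul_le_mul_of_nonneg_left key (by positivity : 0 ≤ 2 * A)
  linear_combination this

lemma L2_bound (a₁ a₂ α₁ α₂ κ₁ κ₂ σ δ τ c : ℝ) (hα₂ : 0 < α₂) (hκ₁ : 0 ≤ κ₁)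
    (hκ₂ : 0 < κ₂) (hσ : 0 ≤ σ) (hδ : 0 ≤ δ) (hδ1 : 2 * δ ≤ 1) (hτ : 0 ≤ τ) (hτ1 : τ ≤ 1)
    (hc : 2 * δ * α₁ - 2 * σ * δ * α₂ + κ₂ * (2 * σ * δ * (2 * σ * δ + 1)) ≤ -c)
    (P Q X z : ℝ) (hP : 0 < P) (hQ : 0 < Q) (hQ2 : Q ≤ 2) (hX : 2 < X) (hz : 0 < z)
    (hzX : 1 ≤ z * X) :
    L2e a₁ a₂ α₁ α₂ κ₁ κ₂ σ δ τ P Q X z + (P + Q) ≤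
      P * (-c * X + (2 * δ * |a₁| + 2 * σ * δ * |a₂| + 1)) + (2 * (|a₂| + α₂) + 1) * X := by
  unfold L2e
  have hX0 : 0 < X := by linarith
  have he0 : 0 ≤ z / X := by positivity
  have hi : 1 / z ≤ X := by rw [div_le_iff₀ hz]; linarith
  have h1 : κ₁ * (2 * δ * (2 * δ - 1)) / X ^ 2 ≤ 0 := by
    apply div_nonpos_of_nonpos_of_nonneg _ (by positivity)
    apply mul_nonpos_of_nonneg_of_nonpos hκ₁
    apply mul_nonpos_of_nonneg_of_nonpos <;> linarith
  have h2 : κ₂ * (2 * σ * δ * (2 * σ * δ + 1)) / z ≤ κ₂ * (2 * σ * δ * (2 * σ * δ + 1)) * X := by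
    rw [div_eq_mul_one_div]; gcongr
  have h3 : κ₂ * (τ * (τ - 1)) / z ≤ 0 := by
    apply div_nonpos_of_nonpos_of_nonneg _ (by positivity)
    apply mul_nonpos_of_nonneg_of_nonpos hκ₂.le
    apply mul_nonpos_of_nonneg_of_nonpos <;> linarith
  have k1 : 2 * δ * (a₁ + α₁ * X - z / X) - 2 * σ * δ * (a₂ + α₂ * X)
    + κ₁ * (2 * δ * (2 * δ - 1)) / X ^ 2 + κ₂ * (2 * σ * δ * (2 * σ * δ + 1)) / z ≤
      -c * X + (2 * δ * |a₁| + 2 * σ * δ * |a₂|) := by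
    have t1 : 2 * δ * a₁ ≤ 2 * δ * |a₁| := by gcongr; exact le_abs_self _
    have t2 : 2 * σ * δ * (-a₂) ≤ 2 * σ * δ * |a₂| := by gcongr; exact neg_le_abs _
    have t3 : 0 ≤ 2 * δ * (z / X) := by positivity
    have t4 := mul_le_mul_of_nonneg_right hc hX0.le
    linear_combination t1 + t2 + t3 + t4 + h1 + h2
  have k2 : Q * (τ * (a₂ + α₂ * X) + κ₂ * (τ * (τ - 1)) / z) ≤ 2 * (|a₂| + α₂) * X := by
    have t1 : τ * (a₂ + α₂ * X) ≤ 1 * (|a₂| * X + α₂ * X) := by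
      have : a₂ ≤ |a₂| * X := by nlinarith [le_abs_self a₂, abs_nonneg a₂]
      have hh : 0 ≤ |a₂| * X + α₂ * X := by positivity
      calc τ * (a₂ + α₂ * X) ≤ τ * (|a₂| * X + α₂ * X) := by gcongr
        _ ≤ _ := by gcongr
    have t2 : τ * (a₂ + α₂ * X) + κ₂ * (τ * (τ - 1)) / z ≤ (|a₂| + α₂) * X := by linarith
    calc _ ≤ Q * ((|a₂| + α₂) * X) := by gcongr
      _ ≤ 2 * ((|a₂| + α₂) * X) := by gcongr
      _ = _ := by ring
  have k3 := mul_le_mul_of_nonneg_left k1 hP.le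
  linarith

set_option maxHeartbeats 1000000 in
lemma T_bound (a₁ a₂ α₁ α₂ κ₁ κ₂ σ δ τ β M₁ M₂ : ℝ) (hα₁ : 0 < α₁) (hα₂ : 0 < α₂)
    (hκ₁ : 0 ≤ κ₁) (hκ₂ : 0 < κ₂) (hσ : 0 ≤ σ) (hδ : 0 ≤ δ) (hτ : 0 ≤ τ) (hτ1 : τ ≤ 1)
    (hβ : 0 ≤ β) (hM₁ : 0 ≤ M₁) (hM₂ : 0 ≤ M₂) : ∃ K₁ K₂ : ℝ, ∀
    (A P Q G1 G2 X z s : ℝ) (_ : 0 < A) (_ : 0 < P) (_ : P ≤ A) (_ : 0 < Q) (_ : Q ≤ 2)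
    (_ : 0 ≤ G1) (_ : G1 ≤ M₁) (_ : |G2| ≤ M₂) (_ : 2 < X) (_ : 0 < z)
    (_ : z * X = s ^ 2) (_ : 1 ≤ s) (_ : s ≤ 2),
    Te a₁ a₂ α₁ α₂ κ₁ κ₂ σ δ τ β A P Q G1 G2 X z s ≤
      A * X * (-(α₁ / 2 + α₂) * G1 + 8 * κ₂ * |G2| + 16 * κ₂ * G1) + K₁ * A + K₂ * X := by
  set E := M₁ * (|a₁| + 1) + M₁ * 2 * |a₂| + κ₁ * (M₂ * 4 + M₁ * 2) with hE
  refine ⟨8 * E + κ₁ * M₁ * 2 * (2 * δ + 8 * (β + 1)),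
    2 * (E + M₁ * α₁ + M₁ * 2 * α₂ + κ₂ * M₂) + 4 * κ₂ * M₁, ?_⟩
  intro A P Q G1 G2 X z s hA hP hPA hQ hQ2 hG1 hGM hG2 hX hz hzX hs1 hs2
  have hX0 : 0 < X := by linarith
  have hs0 : 0 < s := by linarith
  have he0 : 0 ≤ z / X := by positivity
  have hss : s ^ 2 ≤ 4 := by nlinarith
  have hss1 : 1 ≤ s ^ 2 := by nlinarith
  have he1 : z / X ≤ 1 := by
    rw [div_le_one hX0]; nlinarith
  have hX2 : (1:ℝ) ≤ 4 * X ^ 2 := by nlinarith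
  have hX2' : (1:ℝ) ≤ X ^ 2 := by nlinarith
  have hE0 : 0 ≤ E := by positivity
  obtain ⟨q, hq⟩ : ∃ q, P - 2 * A * (5 - s ^ 2) = -(A * q) := by
    refine ⟨-(P - 2 * A * (5 - s ^ 2)) / A, ?_⟩
    field_simp
  have hAs : A * s ^ 2 ≤ A * 4 := by gcongr
  have hAs1 : A * 1 ≤ A * s ^ 2 := by gcongr
  have hq1 : 1 ≤ q := by
    by_contra hc
    push Not at hc
    have : A * q < A * 1 := by gcongr
    linarith
  have hq8 : q ≤ 8 := by
    by_contra hc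
    push Not at hc
    have : A * 8 < A * q := by gcongr
    linarith
  -- the lower order part of Lρ
  obtain ⟨R, hR⟩ : ∃ R, R = G1 * (s / 2) * (a₁ - z / X) + G1 * s * a₂
      + κ₁ * (G2 * s ^ 2 - G1 * s) / (4 * X ^ 2) := ⟨_, rfl⟩
  have hRE : |R| ≤ E := by
    rw [hR]
    have b1 : |G1 * (s / 2) * (a₁ - z / X)| ≤ M₁ * (|a₁| + 1) := by
      rw [abs_mul, abs_of_nonneg (by positivity : 0 ≤ G1 * (s / 2))]
      have t1 : G1 * (s / 2) ≤ M₁ * 1 := by gcongr; linarith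
      have t2 : |a₁ - z / X| ≤ |a₁| + 1 := by
        refine (abs_sub _ _).trans ?_
        rw [abs_of_nonneg he0]; linarith
      rw [mul_one] at t1
      gcongr
    have b2 : |G1 * s * a₂| ≤ M₁ * 2 * |a₂| := by
      rw [abs_mul, abs_of_nonneg (by positivity : 0 ≤ G1 * s)]
      gcongr
    have b3 : |κ₁ * (G2 * s ^ 2 - G1 * s) / (4 * X ^ 2)| ≤ κ₁ * (M₂ * 4 + M₁ * 2) := by
      rw [abs_div, abs_of_pos (by positivity : 0 < 4 * X ^ 2), abs_mul, abs_of_nonneg hκ₁]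
      refine (div_le_self (by positivity) hX2).trans ?_
      gcongr
      refine (abs_sub _ _).trans ?_
      rw [abs_mul, abs_mul, abs_of_nonneg hG1, abs_of_pos hs0, abs_of_nonneg (sq_nonneg s)]
      gcongr
    refine (abs_add_le _ _).trans ?_
    refine add_le_add ((abs_add_le _ _).trans (add_le_add b1 b2)) b3
  have T1 : -(A * q) * (X * ((α₁ / 2 + α₂) * s * G1 + κ₂ * G2)) ≤
      A * X * (-(α₁ / 2 + α₂) * G1 + 8 * κ₂ * |G2|) := by
    have t1 : (α₁ / 2 + α₂) * G1 ≤ q * (α₁ / 2 + α₂) * s * G1 := by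
      have : 1 * (α₁ / 2 + α₂) * 1 * G1 ≤ q * (α₁ / 2 + α₂) * s * G1 := by gcongr
      linarith
    have t2 : -(q * (κ₂ * G2)) ≤ 8 * κ₂ * |G2| := by
      calc -(q * (κ₂ * G2)) = q * κ₂ * (-G2) := by ring
        _ ≤ q * κ₂ * |G2| := by gcongr; exact neg_le_abs _
        _ ≤ _ := by gcongr
    have t3 : -q * ((α₁ / 2 + α₂) * s * G1 + κ₂ * G2) ≤ -(α₁ / 2 + α₂) * G1 + 8 * κ₂ * |G2| := by
      linarith
    have := mul_le_mul_of_nonneg_left t3 (by positivity : 0 ≤ A * X)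
    linear_combination this
  have T2 : -(A * q) * R ≤ 8 * E * A := by
    calc -(A * q) * R = A * q * (-R) := by ring
      _ ≤ A * q * E := by gcongr; exact (neg_le_abs _).trans hRE
      _ ≤ A * 8 * E := by gcongr
      _ = _ := by ring
  have T3 : Q * (X * ((α₁ / 2 + α₂) * s * G1 + κ₂ * G2) + R) ≤
      2 * (E + M₁ * α₁ + M₁ * 2 * α₂ + κ₂ * M₂) * X := by
    have t1 : (α₁ / 2 + α₂) * s * G1 ≤ (α₁ / 2 + α₂) * 2 * M₁ := by gcongr
    have t2 : κ₂ * G2 ≤ κ₂ * M₂ := by gcongr; exact (le_abs_self _).trans hG2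
    have t3 : R ≤ E * X := by
      have := (le_abs_self R).trans hRE
      have h2 : E * 1 ≤ E * X := by gcongr; linarith
      linarith
    have t4 : X * ((α₁ / 2 + α₂) * s * G1 + κ₂ * G2) ≤ X * ((α₁ / 2 + α₂) * 2 * M₁ + κ₂ * M₂) := by
      gcongr
    have t5 : X * ((α₁ / 2 + α₂) * s * G1 + κ₂ * G2) + R ≤
      (E + M₁ * α₁ + M₁ * 2 * α₂ + κ₂ * M₂) * X := by linarith
    calc _ ≤ Q * ((E + M₁ * α₁ + M₁ * 2 * α₂ + κ₂ * M₂) * X) := by gcongr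
      _ ≤ 2 * ((E + M₁ * α₁ + M₁ * 2 * α₂ + κ₂ * M₂) * X) := by gcongr
      _ = _ := by ring
  have T4 : κ₁ * G1 * (s / X ^ 2) * (2 * δ * P - 10 * β * A + 2 * (β + 1) * s ^ 2 * A) ≤
      κ₁ * M₁ * 2 * (2 * δ + 8 * (β + 1)) * A := by
    have t1 : s / X ^ 2 ≤ 2 := (div_le_self hs0.le hX2').trans hs2
    have t2 : 2 * δ * P - 10 * β * A + 2 * (β + 1) * s ^ 2 * A ≤ (2 * δ + 8 * (β + 1)) * A := by
      have u1 : 2 * δ * P ≤ 2 * δ * A := by gcongr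
      have u2 : 2 * (β + 1) * s ^ 2 * A ≤ 2 * (β + 1) * 4 * A := by gcongr
      have u3 : 0 ≤ 10 * β * A := by positivity
      linarith
    calc _ ≤ κ₁ * G1 * (s / X ^ 2) * ((2 * δ + 8 * (β + 1)) * A) := by gcongr
      _ ≤ κ₁ * M₁ * 2 * ((2 * δ + 8 * (β + 1)) * A) := by gcongr
      _ = _ := by ring
  have T5 : 2 * κ₂ * G1 * (X / s) * (-(2 * σ * δ) * P + τ * Q + 4 * s ^ 2 * A) ≤
      A * X * (16 * κ₂ * G1) + 4 * κ₂ * M₁ * X := by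
    have u1 : 0 ≤ 2 * σ * δ * P := by positivity
    have u2 : τ * Q ≤ 1 * 2 := by gcongr
    have u3 : -(2 * σ * δ) * P + τ * Q + 4 * s ^ 2 * A ≤ 2 + 4 * s ^ 2 * A := by linarith
    have u4 : X / s ≤ X := div_le_self hX0.le hs1
    calc _ ≤ 2 * κ₂ * G1 * (X / s) * (2 + 4 * s ^ 2 * A) := by gcongr
      _ = 4 * κ₂ * G1 * (X / s) + 8 * κ₂ * G1 * X * A * s := by field_simp; ring
      _ ≤ 4 * κ₂ * M₁ * X + 8 * κ₂ * G1 * X * A * 2 := by gcongr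
      _ = _ := by ring
  have e : Te a₁ a₂ α₁ α₂ κ₁ κ₂ σ δ τ β A P Q G1 G2 X z s =
      -(A * q) * (X * ((α₁ / 2 + α₂) * s * G1 + κ₂ * G2)) + -(A * q) * R
      + Q * (X * ((α₁ / 2 + α₂) * s * G1 + κ₂ * G2) + R)
      + κ₁ * G1 * (s / X ^ 2) * (2 * δ * P - 10 * β * A + 2 * (β + 1) * s ^ 2 * A)
      + 2 * κ₂ * G1 * (X / s) * (-(2 * σ * δ) * P + τ * Q + 4 * s ^ 2 * A) := by
    unfold Te
    rw [← hq, hR]; ring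
  rw [e]
  linarith

lemma decay (c K p q : ℝ) (hc : 0 < c) (hp : q < p) (hq : 0 ≤ q) :
    ∃ D : ℝ, 0 ≤ D ∧ ∀ X : ℝ, 2 < X → -c * X ^ p + K * X ^ q ≤ D := by
  have h := (tendsto_rpow_atTop (sub_pos.2 hp)).eventually (eventually_ge_atTop (K / c))
  obtain ⟨R, hR⟩ := eventually_atTop.1 h
  refine ⟨|K| * (max R 2) ^ q, by positivity, fun X hX => ?_⟩
  have hX0 : 0 < X := by linarith
  rcases le_total R X with k | k
  · have h1 := hR X k
    rw [div_le_iff₀ hc] at h1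
    have : X ^ p = X ^ (p - q) * X ^ q := by rw [← Real.rpow_add hX0]; ring_nf
    have h2 : K * X ^ q ≤ X ^ (p - q) * c * X ^ q := by gcongr
    have h3 : 0 ≤ |K| * (max R 2) ^ q := by positivity
    rw [this]; linarith
  · have h1 : X ^ q ≤ (max R 2) ^ q := by
      apply Real.rpow_le_rpow hX0.le (k.trans (le_max_left _ _)) hq
    have h2 : 0 ≤ c * X ^ p := by positivity
    have h3 : K * X ^ q ≤ |K| * X ^ q := by gcongr; exact le_abs_self _
    have h4 : |K| * X ^ q ≤ |K| * (max R 2) ^ q := by gcongr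
    linarith

lemma Lop_of_J2 (a₁ a₂ α₁ α₂ κ₁ κ₂ : ℝ) {Φ : ℝ × ℝ → ℝ} {x y fx fxx fy fyy : ℝ}
    (hx : J2 (fun t => Φ (t, y)) x fx fxx) (hy : J2 (fun t => Φ (x, t)) y fy fyy) :
    Lop a₁ a₂ α₁ α₂ κ₁ κ₂ Φ (x, y) =
      (a₁ * x - α₁ * x ^ 2 + y ^ 2) * fx + (a₂ * y - α₂ * x * y) * fy + κ₁ * fxx + κ₂ * fyy := by
  unfold Lop
  simp only
  rw [hx.deriv1, hx.deriv2, hy.deriv1, hy.deriv2]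

lemma phi1_Jx (β y : ℝ) {x : ℝ} (hx : x ≠ 0) :
    J2 (fun t => phi1 β (t, y)) x
      (2 * (5 * (β * |x| ^ β / x) - y ^ 2 * ((β + 1) * (|x| ^ β * |x|) / x)))
      (2 * (5 * (β * (β - 1) * |x| ^ β / x ^ 2) - y ^ 2 * ((β + 1) * β * (|x| ^ β * |x|) / x ^ 2))) := by
  have h := (((J2.abs_rpow β hx).cmul 5).sub ((J2.abs_rpow (β + 1) hx).cmul (y ^ 2))).cmul 2
  rw [Real.rpow_add_one (abs_ne_zero.2 hx)] at h
  exact h.cast rfl (by ring)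

lemma phi1_Jy (β y : ℝ) {x : ℝ} (hx : x ≠ 0) :
    J2 (fun t => phi1 β (x, t)) y
      (2 * (- (2 * y * (|x| ^ β * |x|)))) (2 * (- (2 * (|x| ^ β * |x|)))) := by
  have h := ((J2.const (5 * |x| ^ β) y).sub ((J2.sq y).mulc (|x| ^ (β + 1)))).cmul 2
  rw [Real.rpow_add_one (abs_ne_zero.2 hx)] at h
  refine (h.cast (by ring) (by ring)).congr (Eventually.of_forall fun t => ?_)
  simp only [phi1, Real.rpow_add_one (abs_ne_zero.2 hx)]

lemma phi2_eq (σ δ x : ℝ) {y : ℝ} (hy : y ≠ 0) :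
    phi2 σ δ (x, y) = |x| ^ (2 * δ) * |y| ^ (-(2 * σ * δ)) + |y| ^ (2 * δ * (1 - σ)) := by
  have h := abs_pos.2 hy
  unfold phi2
  simp only
  have e : |y| ^ (2 * δ * (1 - σ)) = |y| ^ (2 * δ) * |y| ^ (-(2 * σ * δ)) := by
    rw [← Real.rpow_add h]; ring_nf
  rw [e, Real.rpow_neg h.le, one_mul, div_eq_mul_inv, add_mul]

lemma phi2_Jx (σ δ : ℝ) {x y : ℝ} (hx : x ≠ 0) (hy : y ≠ 0) :
    J2 (fun t => phi2 σ δ (t, y)) x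
      (2 * δ * |x| ^ (2 * δ) / x * |y| ^ (-(2 * σ * δ)))
      (2 * δ * (2 * δ - 1) * |x| ^ (2 * δ) / x ^ 2 * |y| ^ (-(2 * σ * δ))) := by
  have h := ((J2.abs_rpow (2 * δ) hx).mulc (|y| ^ (-(2 * σ * δ)))).add
    (J2.const (|y| ^ (2 * δ * (1 - σ))) x)
  refine (h.cast (by ring) (by ring)).congr (Eventually.of_forall fun t => ?_)
  exact phi2_eq σ δ t hy

lemma phi2_Jy (σ δ : ℝ) {x y : ℝ} (hy : y ≠ 0) :
    J2 (fun t => phi2 σ δ (x, t)) y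
      (|x| ^ (2 * δ) * (-(2 * σ * δ) * |y| ^ (-(2 * σ * δ)) / y)
        + (2 * δ * (1 - σ)) * |y| ^ (2 * δ * (1 - σ)) / y)
      (|x| ^ (2 * δ) * (-(2 * σ * δ) * (-(2 * σ * δ) - 1) * |y| ^ (-(2 * σ * δ)) / y ^ 2)
        + (2 * δ * (1 - σ)) * ((2 * δ * (1 - σ)) - 1) * |y| ^ (2 * δ * (1 - σ)) / y ^ 2) := by
  have h := ((J2.abs_rpow (-(2 * σ * δ)) hy).cmul (|x| ^ (2 * δ))).add
    (J2.abs_rpow (2 * δ * (1 - σ)) hy)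
  refine h.congr ?_
  filter_upwards [eventually_ne_nhds hy] with t ht
  exact phi2_eq σ δ x ht

lemma rho_Jx {x y c d : ℝ} (hx : x ≠ 0) (hg : J2 gb (|x| ^ ((1:ℝ)/2) * |y| - 1) c d) :
    J2 (fun t => rho12 (t, y)) x
      (c * (|x| ^ ((1:ℝ)/2) * |y| / (2 * x)))
      (d * (|x| ^ ((1:ℝ)/2) * |y| / (2 * x)) ^ 2 - c * (|x| ^ ((1:ℝ)/2) * |y| / (4 * x ^ 2))) := by
  have h := ((J2.abs_rpow ((1:ℝ)/2) hx).mulc |y|).sub (J2.const 1 x)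
  have h2 := J2.comp (f := fun t => |t| ^ ((1:ℝ)/2) * |y| - 1) hg h
  refine h2.cast ?_ ?_
  · field_simp; ring
  · field_simp; ring

lemma rho_Jy {x y c d : ℝ} (hy : y ≠ 0) (hg : J2 gb (|x| ^ ((1:ℝ)/2) * |y| - 1) c d) :
    J2 (fun t => rho12 (x, t)) y
      (c * (|x| ^ ((1:ℝ)/2) * |y| / y))
      (d * (|x| ^ ((1:ℝ)/2) * |y| / y) ^ 2) := by
  have h := ((J2.abs hy).cmul (|x| ^ ((1:ℝ)/2))).sub (J2.const 1 y)
  have h2 := J2.comp (f := fun t => |x| ^ ((1:ℝ)/2) * |t| - 1) hg h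
  refine h2.cast ?_ ?_
  · field_simp; ring
  · field_simp; ring

lemma phi12_eq (σ δ β : ℝ) : phi12 σ δ β =
    fun p => rho12 p * phi2 σ δ p + (1 - rho12 p) * phi1 β p := by
  funext p
  unfold phi12
  split_ifs with h
  · have : rho12 p = 0 := gb_zero (by linarith)
    rw [this]; ring
  · rfl

lemma comb_J2 {r f g : ℝ → ℝ} {x a b c d e k : ℝ} (hr : J2 r x a b) (hf : J2 f x c d)
    (hg : J2 g x e k) : J2 (fun t => r t * f t + (1 - r t) * g t) x
      ((1 - r x) * e + r x * c + a * (f x - g x))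
      ((1 - r x) * k + r x * d + b * (f x - g x) + 2 * a * (c - e)) := by
  have h := (hr.mul hf).add (((J2.const 1 x).sub hr).mul hg)
  exact h.cast (by ring) (by ring)

lemma Lop_phi1 (a₁ a₂ α₁ α₂ κ₁ κ₂ β : ℝ) {x y : ℝ} (hx : x < 0) :
    Lop a₁ a₂ α₁ α₂ κ₁ κ₂ (phi1 β) (x, y) =
      L1e a₁ a₂ α₁ α₂ κ₁ κ₂ β (|x| ^ β) |x| (y ^ 2) := by
  rw [Lop_of_J2 _ _ _ _ _ _ (phi1_Jx β y hx.ne) (phi1_Jy β y hx.ne)]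
  generalize |x| ^ β = A
  rw [abs_of_neg hx]
  unfold L1e
  have := hx.ne
  field_simp
  ring

lemma Lop_phi2 (a₁ a₂ α₁ α₂ κ₁ κ₂ σ δ : ℝ) {x y : ℝ} (hx : x < 0) (hy : y ≠ 0) :
    Lop a₁ a₂ α₁ α₂ κ₁ κ₂ (phi2 σ δ) (x, y) =
      L2e a₁ a₂ α₁ α₂ κ₁ κ₂ σ δ (2 * δ * (1 - σ)) (|x| ^ (2 * δ) * |y| ^ (-(2 * σ * δ)))
        (|y| ^ (2 * δ * (1 - σ))) |x| (y ^ 2) := by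
  rw [Lop_of_J2 _ _ _ _ _ _ (phi2_Jx σ δ hx.ne hy) (phi2_Jy σ δ hy)]
  generalize |x| ^ (2 * δ) = A
  generalize |y| ^ (-(2 * σ * δ)) = B
  generalize |y| ^ (2 * δ * (1 - σ)) = Q
  rw [abs_of_neg hx]
  unfold L2e
  have := hx.ne
  field_simp
  ring

set_option maxHeartbeats 2000000 in
lemma Lop_phi12 (a₁ a₂ α₁ α₂ κ₁ κ₂ σ δ β : ℝ) {x y c d s : ℝ} (hx : x < 0) (hy : y ≠ 0)
    (hs : s = |x| ^ ((1:ℝ)/2) * |y|) (hg : J2 gb (s - 1) c d) :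
    Lop a₁ a₂ α₁ α₂ κ₁ κ₂ (phi12 σ δ β) (x, y) =
      (1 - gb (s - 1)) * L1e a₁ a₂ α₁ α₂ κ₁ κ₂ β (|x| ^ β) |x| (y ^ 2)
      + gb (s - 1) * L2e a₁ a₂ α₁ α₂ κ₁ κ₂ σ δ (2 * δ * (1 - σ))
        (|x| ^ (2 * δ) * |y| ^ (-(2 * σ * δ))) (|y| ^ (2 * δ * (1 - σ))) |x| (y ^ 2)
      + Te a₁ a₂ α₁ α₂ κ₁ κ₂ σ δ (2 * δ * (1 - σ)) β (|x| ^ β)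
        (|x| ^ (2 * δ) * |y| ^ (-(2 * σ * δ))) (|y| ^ (2 * δ * (1 - σ))) c d |x| (y ^ 2) s := by
  have hx0 := hx.ne
  have hs2 : s ^ 2 = |x| * y ^ 2 := by
    rw [hs, mul_pow, sq_abs, ← Real.sqrt_eq_rpow, Real.sq_sqrt (abs_nonneg x)]
  have hs0 : s ≠ 0 := by
    intro h0
    rw [h0] at hs2
    have : |x| * y ^ 2 ≠ 0 := by positivity
    apply this; rw [← hs2]; norm_num
  rw [← Lop_phi1 _ _ _ _ _ _ _ hx, ← Lop_phi2 _ _ _ _ _ _ _ _ hx hy]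
  rw [Lop_of_J2 _ _ _ _ _ _ (phi1_Jx β y hx.ne) (phi1_Jy β y hx.ne)]
  rw [Lop_of_J2 _ _ _ _ _ _ (phi2_Jx σ δ hx.ne hy) (phi2_Jy σ δ hy)]
  rw [phi12_eq]
  have hg' := hg
  rw [hs] at hg'
  rw [Lop_of_J2 _ _ _ _ _ _
    (comb_J2 (rho_Jx hx0 hg') (phi2_Jx σ δ hx.ne hy) (phi1_Jx β y hx.ne))
    (comb_J2 (rho_Jy hy hg') (phi2_Jy σ δ hy) (phi1_Jy β y hx.ne))]
  have hr : rho12 (x, y) = gb (s - 1) := by rw [hs]; rfl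
  rw [hr, phi2_eq σ δ x hy, ← hs]
  have hp1 : phi1 β (x, y) = 2 * |x| ^ β * (5 - s ^ 2) := by
    unfold phi1; simp only; rw [Real.rpow_add_one (abs_ne_zero.2 hx0), hs2]; ring
  rw [hp1]
  generalize |x| ^ β = A
  generalize |x| ^ (2 * δ) = B
  generalize |y| ^ (-(2 * σ * δ)) = C
  generalize |y| ^ (2 * δ * (1 - σ)) = Q
  rw [abs_of_neg hx] at hs2 ⊢
  unfold Te
  have hxe : x = -(s ^ 2 / y ^ 2) := by rw [hs2]; field_simp
  clear hp1 hr hg' hg hs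
  generalize gb (s - 1) = G
  clear hs2 hx
  subst hxe
  field_simp
  ring

lemma U_sub {z : ℝ × ℝ} (hz : z ∈ U1 ∪ U2) : z.1 < -2 ∧ |z.2| < 2 := by
  rcases hz with h | h
  · refine ⟨h.1, lt_of_lt_of_le h.2 ?_⟩
    have h1 : 1 ≤ |z.1| := by rw [abs_of_neg (by linarith [h.1])]; linarith [h.1]
    have := Real.rpow_le_one_of_one_le_of_nonpos h1 (z := -(1:ℝ)/2) (by norm_num)
    linarith
  · exact ⟨h.1, h.2.2⟩

lemma s_sq (x y : ℝ) : (|x| ^ ((1:ℝ)/2) * |y|) ^ 2 = y ^ 2 * |x| := by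
  rw [mul_pow, sq_abs, ← Real.sqrt_eq_rpow, Real.sq_sqrt (abs_nonneg x)]; ring

lemma P_eq (σ δ : ℝ) {x y : ℝ} (hx : x ≠ 0) :
    |x| ^ (2 * δ) * |y| ^ (-(2 * σ * δ)) =
      |x| ^ ((2 + σ) * δ) * (|x| ^ ((1:ℝ)/2) * |y|) ^ (-(2 * σ * δ)) := by
  have hX := abs_pos.2 hx
  rw [Real.mul_rpow (by positivity) (by positivity), ← Real.rpow_mul hX.le, ← mul_assoc,
    ← Real.rpow_add hX]
  congr 2; ring

lemma rpow_neg_ge_half {u p : ℝ} (hu : 0 < u) (hu2 : u ≤ 2) (hp : 0 ≤ p) (hp1 : p ≤ 1) :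
    1 / 2 ≤ u ^ (-p) := by
  have h1 : (2:ℝ) ^ (-p) ≤ u ^ (-p) := Real.rpow_le_rpow_of_nonpos hu hu2 (by linarith)
  have h2 : (2:ℝ) ^ (-(1:ℝ)) ≤ 2 ^ (-p) :=
    Real.rpow_le_rpow_of_exponent_le (by norm_num) (by linarith)
  rw [Real.rpow_neg_one] at h2
  linarith

lemma rpow_le_two {u p : ℝ} (hu : 0 < u) (hu2 : u ≤ 2) (hp : 0 ≤ p) (hp1 : p ≤ 1) :
    u ^ p ≤ 2 := by
  have h1 : u ^ p ≤ 2 ^ p := Real.rpow_le_rpow hu.le hu2 hp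
  have h2 : (2:ℝ) ^ p ≤ 2 ^ (1:ℝ) :=
    Real.rpow_le_rpow_of_exponent_le (by norm_num) (by linarith)
  rw [Real.rpow_one] at h2
  linarith

lemma phi1_eq (β : ℝ) {x y : ℝ} (hx : x ≠ 0) :
    phi1 β (x, y) = 2 * |x| ^ β * (5 - y ^ 2 * |x|) := by
  unfold phi1; simp only; rw [Real.rpow_add_one (abs_ne_zero.2 hx)]; ring

lemma combine_tr (α₁ α₂ κ₂ c M K₁ K₂ K₃ K₄ K₅ A P X g G1 G2 V1 V2 T : ℝ) (hα₁ : 0 < α₁)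
    (hκ₂ : 0 < κ₂) (hc : 0 < c) (hK₁ : 0 ≤ K₁) (hK₂ : 0 ≤ K₂) (hK₃ : 0 ≤ K₃)
    (hκ : κ₂ * (8 * M + 16) ≤ α₂) (hA : 0 < A) (hX : 0 < X) (hPA : P ≤ A) (hAP : A / 2 ≤ P)
    (hg0 : 0 ≤ g) (hg1 : g ≤ 1) (hG1 : 0 ≤ G1) (hG2 : G2 ≤ c / 16 + M * G1)
    (h1 : V1 ≤ -(c * κ₂) * (A * X) + K₁ * A)
    (h2 : V2 ≤ P * (-(2 * (c * κ₂)) * X + K₂) + K₃ * X)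
    (hT : T ≤ A * X * (-(α₁ / 2 + α₂) * G1 + 8 * κ₂ * G2 + 16 * κ₂ * G1) + K₄ * A + K₅ * X) :
    (1 - g) * V1 + g * V2 + T ≤ -(c * κ₂ / 2) * (A * X) + (K₁ + K₂ + K₄) * A + (K₃ + K₅) * X := by
  obtain ⟨W, hW⟩ : ∃ W, W = -(c * κ₂) * (A * X) + (K₁ + K₂) * A + K₃ * X := ⟨_, rfl⟩
  have e1 : V1 ≤ W := by
    have := mul_nonneg hK₂ hA.le
    have := mul_nonneg hK₃ hX.le
    rw [hW]; linarith
  have e2 : V2 ≤ W := by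
    have u1 := mul_nonneg hK₁ hA.le
    have u2 : P * K₂ ≤ A * K₂ := by gcongr
    have u3 : A / 2 * (2 * (c * κ₂) * X) ≤ P * (2 * (c * κ₂) * X) := by gcongr
    rw [hW]; linarith
  have e3 : (1 - g) * V1 + g * V2 ≤ W := by
    have u1 : (1 - g) * V1 ≤ (1 - g) * W := mul_le_mul_of_nonneg_left e1 (by linarith)
    have u2 : g * V2 ≤ g * W := mul_le_mul_of_nonneg_left e2 hg0
    linarith
  have e4 : -(α₁ / 2 + α₂) * G1 + 8 * κ₂ * G2 + 16 * κ₂ * G1 ≤ c * κ₂ / 2 := by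
    have u1 : 8 * κ₂ * G2 ≤ 8 * κ₂ * (c / 16 + M * G1) := by gcongr
    have u2 : κ₂ * (8 * M + 16) * G1 ≤ α₂ * G1 := by gcongr
    have u3 : 0 ≤ α₁ / 2 * G1 := by positivity
    linarith
  have e5 : A * X * (-(α₁ / 2 + α₂) * G1 + 8 * κ₂ * G2 + 16 * κ₂ * G1) ≤ A * X * (c * κ₂ / 2) := by
    gcongr
  linarith

lemma combine_2 (C K₂ K₃ A B P X V D₂ D₃ : ℝ) (hC : 0 < C) (hP : 0 < P)
    (hX : 0 < X) (hPA : P ≤ A) (hPB : B / 2 ≤ P) (hD₂ : 0 ≤ D₂)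
    (h2 : V ≤ P * (-(2 * C) * X + K₂) + K₃ * X)
    (d2 : -C * (A * X) + K₂ * A ≤ D₂) (d3 : -(C / 2) * (B * X) + K₃ * X ≤ D₃) :
    V ≤ D₂ + D₃ := by
  have e1 : P * (-C * X + K₂) ≤ D₂ := by
    rcases le_total (-C * X + K₂) 0 with h | h
    · exact (mul_nonpos_of_nonneg_of_nonpos hP.le h).trans hD₂
    · have : P * (-C * X + K₂) ≤ A * (-C * X + K₂) := by gcongr
      linarith
  have e2 : B / 2 * (C * X) ≤ P * (C * X) := by gcongr
  linarith

lemma mul_ge_half_mul {a b : ℝ} (ha : 0 < a) (hb : 1 / 2 ≤ b) : a / 2 ≤ a * b := by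
  have : a * (1 / 2) ≤ a * b := by gcongr
  linarith

set_option maxHeartbeats 1000000 in
lemma partIII (a₁ a₂ α₁ α₂ κ₁ κ₂ σ δ β c M : ℝ) (hα₁ : 0 < α₁) (hα₂ : 0 < α₂)
    (hκ₁ : 0 ≤ κ₁) (hκ₂ : 0 < κ₂) (hσ : 0 < σ) (hσ1 : σ < 1) (hδ : 0 < δ) (hδ1 : δ ≤ 1 / 4)
    (hβ : β = (2 + σ) * δ) (hc : 0 < c) (hM : 0 < M)
    (hc1 : c * κ₂ ≤ 2 * (2 * κ₂ - 5 * β * α₁))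
    (hc2 : 2 * δ * α₁ - 2 * σ * δ * α₂ + κ₂ * (2 * σ * δ * (2 * σ * δ + 1)) ≤ -(2 * (c * κ₂)))
    (hG : ∀ t, |(∫ s, fb s)⁻¹ * deriv fb t| ≤ c / 16 + M * ((∫ s, fb s)⁻¹ * fb t))
    (hκ : κ₂ * (8 * M + 16) ≤ α₂) :
    ∃ D > (0:ℝ), ∀ x y : ℝ, x < -2 → |y| < 2 →
      Lop a₁ a₂ α₁ α₂ κ₁ κ₂ (phi12 σ δ β) (x, y) ≤ -1 * phi12 σ δ β (x, y) + D := by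
  have hβ0 : 0 < β := by rw [hβ]; positivity
  have hI := fb_int_pos
  set I := ∫ s, fb s with hIdef
  have hI' : 0 < I⁻¹ := inv_pos.2 hI
  have hc0 : 0 < c * κ₂ := by positivity
  have hσδ : σ * δ ≤ 1 / 4 := by nlinarith
  have hτ : 0 ≤ 2 * δ * (1 - σ) := mul_nonneg (by linarith) (by linarith)
  have hτ1 : 2 * δ * (1 - σ) ≤ 1 := by nlinarith
  obtain ⟨K₁, hK₁⟩ : ∃ K, K = 2 * ((5 * β + 4 * (β + 1)) * (|a₁| + 1) + 8 * |a₂|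
    + 5 * κ₁ * β ^ 2 + 5) := ⟨_, rfl⟩
  obtain ⟨K₂, hK₂⟩ : ∃ K, K = 2 * δ * |a₁| + 2 * σ * δ * |a₂| + 1 := ⟨_, rfl⟩
  obtain ⟨K₃, hK₃⟩ : ∃ K, K = 2 * (|a₂| + α₂) + 1 := ⟨_, rfl⟩
  have hK₁0 : 0 ≤ K₁ := by rw [hK₁]; positivity
  have hK₂0 : 0 ≤ K₂ := by rw [hK₂]; positivity
  have hK₃0 : 0 ≤ K₃ := by rw [hK₃]; positivity
  obtain ⟨K₄, K₅, hT⟩ := T_bound a₁ a₂ α₁ α₂ κ₁ κ₂ σ δ (2 * δ * (1 - σ)) β I⁻¹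
    (c / 16 + M * I⁻¹) hα₁ hα₂ hκ₁ hκ₂ hσ.le hδ.le hτ hτ1 hβ0.le hI'.le (by positivity)
  obtain ⟨D₁, hD₁0, hD₁⟩ := decay (c * κ₂) K₁ (β + 1) β hc0 (by linarith) hβ0.le
  obtain ⟨D₂, hD₂0, hD₂⟩ := decay (c * κ₂) K₂ (β + 1) β hc0 (by linarith) hβ0.le
  obtain ⟨D₃, hD₃0, hD₃⟩ := decay (c * κ₂ / 2) K₃ (2 * δ + 1) 1 (by positivity) (by linarith)
    (by norm_num)
  obtain ⟨D₄, hD₄0, hD₄⟩ := decay (c * κ₂ / 4) (K₁ + K₂ + K₄) (β + 1) β (by positivity)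
    (by linarith) hβ0.le
  obtain ⟨D₅, hD₅0, hD₅⟩ := decay (c * κ₂ / 4) (K₃ + K₅) (β + 1) 1 (by positivity)
    (by linarith) (by norm_num)
  refine ⟨D₁ + D₂ + D₃ + D₄ + D₅ + 1, by positivity, fun x y hx hy => ?_⟩
  have hx0 : x < 0 := by linarith
  have hX : 2 < |x| := by rw [abs_of_neg hx0]; linarith
  have hX0 : 0 < |x| := by linarith
  have hA : 0 < |x| ^ β := by positivity
  obtain ⟨s, hs⟩ : ∃ s, s = |x| ^ ((1:ℝ)/2) * |y| := ⟨_, rfl⟩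
  have hss : y ^ 2 * |x| = s ^ 2 := by rw [hs, s_sq]
  have hs0 : 0 ≤ s := by rw [hs]; positivity
  have eβ1 : |x| ^ (β + 1) = |x| ^ β * |x| := Real.rpow_add_one hX0.ne' _
  have eδ1 : |x| ^ (2 * δ + 1) = |x| ^ (2 * δ) * |x| := Real.rpow_add_one hX0.ne' _
  have hAX : 0 < |x| ^ β * |x| := by positivity
  have hL1 : s ≤ 2 → L1e a₁ a₂ α₁ α₂ κ₁ κ₂ β (|x| ^ β) |x| (y ^ 2)
      + 2 * |x| ^ β * (5 - y ^ 2 * |x|) ≤ -(c * κ₂) * (|x| ^ β * |x|) + K₁ * |x| ^ β := by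
    intro hs2
    have := L1_bound a₁ a₂ α₁ α₂ κ₁ κ₂ β hα₁ hα₂ hκ₁ hβ0.le (|x| ^ β) |x| (y ^ 2) hA hX
      (sq_nonneg y) (by rw [hss]; exact (pow_le_pow_left₀ hs0 hs2 2).trans (by norm_num))
    rw [← hK₁] at this
    have h2 : c * κ₂ * (|x| ^ β * |x|) ≤ 2 * (2 * κ₂ - 5 * β * α₁) * (|x| ^ β * |x|) := by gcongr
    linarith
  rcases lt_or_ge s 1 with h1 | h1
  · -- region 1
    have e1 : (fun t => phi12 σ δ β (t, y)) =ᶠ[𝓝 x] fun t => phi1 β (t, y) := by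
      have hcont : ContinuousAt (fun t : ℝ => |t| ^ ((1:ℝ)/2) * |y|) x :=
        ((continuous_abs.continuousAt).rpow_const (Or.inr (by norm_num))).mul continuousAt_const
      have := Filter.Tendsto.eventually_lt_const (show |x| ^ ((1:ℝ)/2) * |y| < 1 from hs ▸ h1) hcont
      filter_upwards [this] with t ht
      exact if_pos ht.le
    have e2 : (fun t => phi12 σ δ β (x, t)) =ᶠ[𝓝 y] fun t => phi1 β (x, t) := by
      have hcont : ContinuousAt (fun t : ℝ => |x| ^ ((1:ℝ)/2) * |t|) y := by fun_prop
      have := Filter.Tendsto.eventually_lt_const (show |x| ^ ((1:ℝ)/2) * |y| < 1 from hs ▸ h1) hcont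
      filter_upwards [this] with t ht
      exact if_pos ht.le
    have eL : Lop a₁ a₂ α₁ α₂ κ₁ κ₂ (phi12 σ δ β) (x, y) =
        Lop a₁ a₂ α₁ α₂ κ₁ κ₂ (phi1 β) (x, y) := by
      rw [Lop_of_J2 _ _ _ _ _ _ ((phi1_Jx β y hx0.ne).congr e1) ((phi1_Jy β y hx0.ne).congr e2),
        Lop_of_J2 _ _ _ _ _ _ (phi1_Jx β y hx0.ne) (phi1_Jy β y hx0.ne)]
    have ev : phi12 σ δ β (x, y) = phi1 β (x, y) := e1.self_of_nhds
    rw [eL, ev, Lop_phi1 _ _ _ _ _ _ _ hx0, phi1_eq β hx0.ne]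
    have := hL1 (by linarith)
    have h2 := hD₁ |x| hX
    rw [eβ1] at h2
    linarith
  have hy0 : y ≠ 0 := by
    rintro rfl
    simp at hs
    linarith
  have hY : 0 < |y| := abs_pos.2 hy0
  have hz : 0 < y ^ 2 := by positivity
  have hJ := gb_J2 (s - 1)
  rw [← hIdef] at hJ
  have hform := Lop_phi12 a₁ a₂ α₁ α₂ κ₁ κ₂ σ δ β hx0 hy0 hs hJ
  have hval : phi12 σ δ β (x, y) = gb (s - 1) * (|x| ^ (2 * δ) * |y| ^ (-(2 * σ * δ))
      + |y| ^ (2 * δ * (1 - σ))) + (1 - gb (s - 1)) * (2 * |x| ^ β * (5 - y ^ 2 * |x|)) := by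
    rw [phi12_eq, ← phi2_eq σ δ x hy0, ← phi1_eq β hx0.ne, hs]; rfl
  have hP : 0 < |x| ^ (2 * δ) * |y| ^ (-(2 * σ * δ)) := by positivity
  have hQ : 0 < |y| ^ (2 * δ * (1 - σ)) := by positivity
  have hQ2 : |y| ^ (2 * δ * (1 - σ)) ≤ 2 := rpow_le_two hY hy.le hτ hτ1
  have hPA : |x| ^ (2 * δ) * |y| ^ (-(2 * σ * δ)) ≤ |x| ^ β := by
    rw [P_eq σ δ hx0.ne, ← hs, ← hβ]
    have : s ^ (-(2 * σ * δ)) ≤ 1 :=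
      Real.rpow_le_one_of_one_le_of_nonpos h1 (neg_nonpos.2 (by positivity))
    exact mul_le_of_le_one_right hA.le this
  have hPX : |x| ^ (2 * δ) / 2 ≤ |x| ^ (2 * δ) * |y| ^ (-(2 * σ * δ)) := by
    have := rpow_neg_ge_half hY hy.le (p := 2 * σ * δ) (by positivity) (by linarith)
    exact mul_ge_half_mul (by positivity) this
  have hPA2 : s ≤ 2 → |x| ^ β / 2 ≤ |x| ^ (2 * δ) * |y| ^ (-(2 * σ * δ)) := by
    intro hs2
    rw [P_eq σ δ hx0.ne, ← hs, ← hβ]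
    have := rpow_neg_ge_half (u := s) (by linarith) hs2 (p := 2 * σ * δ) (by positivity)
      (by linarith)
    exact mul_ge_half_mul hA this
  have hL2 := L2_bound a₁ a₂ α₁ α₂ κ₁ κ₂ σ δ (2 * δ * (1 - σ)) (2 * (c * κ₂)) hα₂ hκ₁ hκ₂ hσ.le
    hδ.le (by linarith) hτ hτ1 hc2 (|x| ^ (2 * δ) * |y| ^ (-(2 * σ * δ)))
    (|y| ^ (2 * δ * (1 - σ))) |x| (y ^ 2) hP hQ hQ2 hX hz (by rw [hss]; exact one_le_pow₀ h1)
  rw [← hK₂, ← hK₃] at hL2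
  rw [hform, hval]
  have hTs := hT (|x| ^ β) (|x| ^ (2 * δ) * |y| ^ (-(2 * σ * δ))) (|y| ^ (2 * δ * (1 - σ)))
    (I⁻¹ * fb (s - 1)) (I⁻¹ * deriv fb (s - 1)) |x| (y ^ 2) s hA hP hPA hQ hQ2
    (mul_nonneg hI'.le (fb_nonneg _))
    (mul_le_of_le_one_right hI'.le (fb_le_one _))
    ((hG _).trans (by
      have : M * (I⁻¹ * fb (s - 1)) ≤ M * I⁻¹ :=
        mul_le_mul_of_nonneg_left (mul_le_of_le_one_right hI'.le (fb_le_one _)) hM.le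
      linarith only [this])) hX hz hss h1
  have hG1 : 0 ≤ I⁻¹ * fb (s - 1) := mul_nonneg hI'.le (fb_nonneg _)
  have hGs := hG (s - 1)
  have hg0 := gb_nonneg (s - 1)
  have hg1 := gb_le_one (s - 1)
  have hfz : 2 ≤ s → fb (s - 1) = 0 := fun h => fb_zero fun k => by linarith [k.2]
  have hdfz : 2 ≤ s → deriv fb (s - 1) = 0 := fun h => deriv_fb_zero fun k => by linarith [k.2]
  have hgz : 2 ≤ s → gb (s - 1) = 1 := fun h => gb_one (by linarith)
  have d2 := hD₂ |x| hX
  have d3 := hD₃ |x| hX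
  have d4 := hD₄ |x| hX
  have d5 := hD₅ |x| hX
  rw [eβ1] at d2 d4 d5
  rw [eδ1] at d3
  rw [Real.rpow_one] at d3 d5
  rcases le_or_gt s 2 with h2 | h2
  · have := combine_tr α₁ α₂ κ₂ c M K₁ K₂ K₃ K₄ K₅ _ _ _ (gb (s - 1)) _ _ _ _ _ hα₁ hκ₂ hc hK₁0
      hK₂0 hK₃0 hκ hA hX0 hPA (hPA2 h2) hg0 hg1 hG1 hGs (hL1 h2) hL2 (hTs h2)
    linarith only [this, d4, d5, hD₁0, hD₂0, hD₃0]
  · have hz1 := hfz h2.le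
    have hz2 := hdfz h2.le
    rw [hgz h2.le, hz1, hz2]
    have := combine_2 (c * κ₂) K₂ K₃ _ _ _ _ _ D₂ D₃ hc0 hP hX0 hPA hPX hD₂0 hL2 d2 d3
    have hT0 : Te a₁ a₂ α₁ α₂ κ₁ κ₂ σ δ (2 * δ * (1 - σ)) β (|x| ^ β)
        (|x| ^ (2 * δ) * |y| ^ (-(2 * σ * δ))) (|y| ^ (2 * δ * (1 - σ))) (I⁻¹ * 0) (I⁻¹ * 0)
        |x| (y ^ 2) s = 0 := by
      unfold Te; ring
    rw [hT0]
    linarith only [this, hD₁0, hD₄0, hD₅0]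

lemma cd_abs_rpow_fst (p : ℝ) {z : ℝ × ℝ} (hx : z.1 ≠ 0) :
    ContDiffAt ℝ (⊤ : ℕ∞) (fun z : ℝ × ℝ => |z.1| ^ p) z :=
  ((contDiffAt_abs hx).comp z contDiffAt_fst).rpow_const_of_ne (abs_ne_zero.2 hx)

lemma cd_abs_rpow_snd (p : ℝ) {z : ℝ × ℝ} (hx : z.2 ≠ 0) :
    ContDiffAt ℝ (⊤ : ℕ∞) (fun z : ℝ × ℝ => |z.2| ^ p) z :=
  ((contDiffAt_abs hx).comp z contDiffAt_snd).rpow_const_of_ne (abs_ne_zero.2 hx)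

lemma cd_phi1 (β : ℝ) {z : ℝ × ℝ} (hx : z.1 ≠ 0) : ContDiffAt ℝ (⊤ : ℕ∞) (phi1 β) z := by
  unfold phi1
  exact contDiffAt_const.mul ((contDiffAt_const.mul (cd_abs_rpow_fst β hx)).sub
    ((contDiffAt_snd.pow 2).mul (cd_abs_rpow_fst (β + 1) hx)))

lemma partI (σ δ β : ℝ) {z : ℝ × ℝ} (hx : z.1 ≠ 0) :
    ContDiffAt ℝ (⊤ : ℕ∞) (phi12 σ δ β) z := by
  by_cases hy : z.2 = 0
  · refine (cd_phi1 β hx).congr_of_eventuallyEq ?_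
    have hcont : ContinuousAt (fun z : ℝ × ℝ => |z.1| ^ ((1:ℝ)/2) * |z.2|) z :=
      (cd_abs_rpow_fst _ hx).continuousAt.mul (by fun_prop)
    have := Filter.Tendsto.eventually_lt_const
      (show |z.1| ^ ((1:ℝ)/2) * |z.2| < 1 by simp [hy]) hcont
    filter_upwards [this] with t ht
    exact if_pos ht.le
  · rw [phi12_eq]
    have hr : ContDiffAt ℝ (⊤ : ℕ∞) rho12 z := by
      unfold rho12
      refine gb_contDiff.contDiffAt.comp z (((cd_abs_rpow_fst _ hx).mul ?_).sub contDiffAt_const)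
      exact (contDiffAt_abs hy).comp z contDiffAt_snd
    have h2 : ContDiffAt ℝ (⊤ : ℕ∞) (phi2 σ δ) z := by
      unfold phi2
      refine contDiffAt_const.mul (((cd_abs_rpow_fst _ hx).add (cd_abs_rpow_snd _ hy)).div
        (cd_abs_rpow_snd _ hy) ?_)
      have := abs_pos.2 hy
      positivity
    exact (hr.mul h2).add ((contDiffAt_const.sub hr).mul (cd_phi1 β hx))

lemma partII (σ δ β : ℝ) (hσ : 0 < σ) (hσ1 : σ < 1) (hδ : 0 < δ) (hδ1 : δ ≤ 1 / 4)
    (hβ : β = (2 + σ) * δ) {x y : ℝ} (hx : x < -2) (hy : |y| < 2) :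
    |x| ^ (2 * δ) / 2 ≤ phi12 σ δ β (x, y) := by
  have hx0 : x < 0 := by linarith
  have hX : 2 < |x| := by rw [abs_of_neg hx0]; linarith
  have hAB : |x| ^ (2 * δ) ≤ |x| ^ β :=
    Real.rpow_le_rpow_of_exponent_le (by linarith) (by rw [hβ]; nlinarith)
  have hB : 0 < |x| ^ (2 * δ) := by positivity
  have h1 : |x| ^ ((1:ℝ)/2) * |y| ≤ 2 → |x| ^ (2 * δ) / 2 ≤ phi1 β (x, y) := by
    intro hs
    have := pow_le_pow_left₀ (by positivity) hs 2
    rw [s_sq] at this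
    rw [phi1_eq β hx0.ne]
    have h3 : 2 * |x| ^ β * 1 ≤ 2 * |x| ^ β * (5 - y ^ 2 * |x|) := by gcongr; linarith
    linarith
  have h2 : y ≠ 0 → |x| ^ (2 * δ) / 2 ≤ phi2 σ δ (x, y) := by
    intro hy0
    have hY := abs_pos.2 hy0
    rw [phi2_eq σ δ x hy0]
    have := mul_ge_half_mul hB
      (rpow_neg_ge_half hY hy.le (p := 2 * σ * δ) (by positivity) (by nlinarith))
    have : 0 < |y| ^ (2 * δ * (1 - σ)) := by positivity
    linarith
  unfold phi12
  simp only
  split_ifs with h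
  · exact h1 (by linarith)
  · have hy0 : y ≠ 0 := by
      rintro rfl
      simp at h
    have hg0 : 0 ≤ rho12 (x, y) := gb_nonneg _
    have hg1 : rho12 (x, y) ≤ 1 := gb_le_one _
    rcases le_total (|x| ^ ((1:ℝ)/2) * |y|) 2 with k | k
    · have u1 := mul_le_mul_of_nonneg_left (h2 hy0) hg0
      have u2 := mul_le_mul_of_nonneg_left (h1 k) (sub_nonneg.2 hg1)
      linarith
    · have : rho12 (x, y) = 1 := gb_one (by simp only; linarith)
      rw [this]
      have := h2 hy0
      linarith

/-- Patch 1. For small enough `κ₂`, `φ_{1,2}` is a Lyapunov function on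
`U₁ ∪ U₂`, for all `a₁, a₂` and all `κ₁ ≥ 0`. -/
theorem statement7 (α₁ α₂ : ℝ) (hα₁ : 0 < α₁) (hα : α₁ < α₂) :
    ∃ κs > (0:ℝ), ∀ κ₂ : ℝ, 0 < κ₂ → κ₂ ≤ κs → ∀ a₁ a₂ : ℝ, ∀ κ₁ ≥ (0:ℝ),
      IsLyapunovOn a₁ a₂ α₁ α₂ κ₁ κ₂
        (phi12 ((α₁ + α₂) / (2 * α₂)) (κ₂ / (8 * α₁))
          ((2 + (α₁ + α₂) / (2 * α₂)) * (κ₂ / (8 * α₁))))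
        (U1 ∪ U2) := by
  have hα₂ : 0 < α₂ := by linarith
  have hI := fb_int_pos
  obtain ⟨c, hc⟩ : ∃ c, c = min (1 / 4) ((α₂ - α₁) / (32 * α₁)) := ⟨_, rfl⟩
  have hd : 0 < α₂ - α₁ := by linarith
  have hc0 : 0 < c := by rw [hc]; positivity
  obtain ⟨M, hM0, hM⟩ := deriv_fb_bound ((∫ s, fb s) * (c / 16)) (by positivity)
  refine ⟨min (2 * α₁) (min ((α₂ - α₁) / 8) (α₂ / (8 * M + 16))), by positivity, ?_⟩
  intro κ₂ hκ₂ hκs a₁ a₂ κ₁ hκ₁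
  have hκ1 : κ₂ ≤ 2 * α₁ := hκs.trans (min_le_left _ _)
  have hκ2 : κ₂ ≤ (α₂ - α₁) / 8 := hκs.trans ((min_le_right _ _).trans (min_le_left _ _))
  have hκ3 : κ₂ ≤ α₂ / (8 * M + 16) := hκs.trans ((min_le_right _ _).trans (min_le_right _ _))
  rw [le_div_iff₀ (by positivity)] at hκ3
  obtain ⟨σ, hσ⟩ : ∃ σ, σ = (α₁ + α₂) / (2 * α₂) := ⟨_, rfl⟩
  obtain ⟨δ, hδ⟩ : ∃ δ, δ = κ₂ / (8 * α₁) := ⟨_, rfl⟩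
  rw [← hσ, ← hδ]
  have hσ0 : 0 < σ := by rw [hσ]; positivity
  have hσ1 : σ < 1 := by rw [hσ, div_lt_one (by positivity)]; linarith
  have hδ0 : 0 < δ := by rw [hδ]; positivity
  have hδ1 : δ ≤ 1 / 4 := by rw [hδ, div_le_iff₀ (by positivity)]; linarith
  have hσα : σ * α₂ = (α₁ + α₂) / 2 := by rw [hσ]; field_simp
  have hδα : δ * α₁ = κ₂ / 8 := by rw [hδ]; field_simp
  obtain ⟨β, hβ⟩ : ∃ β, β = (2 + σ) * δ := ⟨_, rfl⟩
  rw [← hβ]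
  refine ⟨fun z hz => ?_, ?_, 1, one_pos, ?_⟩
  · exact (partI σ δ β (by have := (U_sub hz).1; linarith)).contDiffWithinAt
  · intro m
    have ht := (tendsto_rpow_atTop (by positivity : 0 < 2 * δ)).eventually
      (eventually_gt_atTop (2 * m))
    obtain ⟨R, hR⟩ := eventually_atTop.1 ht
    refine ⟨max R 2, fun z hz hzR => ?_⟩
    obtain ⟨h1, h2⟩ := U_sub hz
    obtain ⟨x, y⟩ := z
    have := partII σ δ β hσ0 hσ1 hδ0 hδ1 hβ h1 h2
    have hx : R ≤ |x| := by
      rw [Prod.norm_def, lt_max_iff] at hzR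
      simp only [Real.norm_eq_abs] at hzR
      rcases hzR with k | k
      · exact (le_max_left _ _).trans k.le
      · exact absurd (le_max_right R 2) (not_le.2 (k.trans h2))
    have h3 := hR |x| hx
    linarith
  · have hc1 : c * κ₂ ≤ 2 * (2 * κ₂ - 5 * β * α₁) := by
      have e : 5 * β * α₁ = 5 * (2 + σ) * (κ₂ / 8) := by rw [hβ, ← hδα]; ring
      have : c ≤ 1 / 4 := hc ▸ min_le_left _ _
      have h2 : c * κ₂ ≤ 1 / 4 * κ₂ := by gcongr
      have h3 : σ * κ₂ ≤ 1 * κ₂ := by gcongr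
      rw [e]; linarith
    have hc2 : 2 * δ * α₁ - 2 * σ * δ * α₂ + κ₂ * (2 * σ * δ * (2 * σ * δ + 1))
        ≤ -(2 * (c * κ₂)) := by
      have h1 : c * κ₂ ≤ δ * (α₂ - α₁) / 4 := by
        have : c ≤ (α₂ - α₁) / (32 * α₁) := hc ▸ min_le_right _ _
        have h2 : c * κ₂ ≤ (α₂ - α₁) / (32 * α₁) * κ₂ := by gcongr
        refine h2.trans (le_of_eq ?_)
        rw [hδ]; field_simp; norm_num
      have h2 : κ₂ * (2 * σ * δ * (2 * σ * δ + 1)) ≤ (α₂ - α₁) / 8 * (2 * 1 * δ * (1 + 1)) := by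
        have : 2 * σ * δ ≤ 1 := by nlinarith
        gcongr
      have e : 2 * σ * δ * α₂ = δ * (α₁ + α₂) := by
        linear_combination 2 * δ * hσα
      rw [e]
      linarith
    have hG : ∀ t, |(∫ s, fb s)⁻¹ * deriv fb t| ≤ c / 16 + M * ((∫ s, fb s)⁻¹ * fb t) := by
      intro t
      rw [abs_mul, abs_of_pos (inv_pos.2 hI)]
      have := mul_le_mul_of_nonneg_left (hM t) (inv_pos.2 hI).le
      refine this.trans (le_of_eq ?_)
      rw [mul_add, inv_mul_cancel_left₀ hI.ne']; ring
    obtain ⟨D, hD0, hD⟩ := partIII a₁ a₂ α₁ α₂ κ₁ κ₂ σ δ β c M hα₁ hα₂ hκ₁ hκ₂ hσ0 hσ1 hδ0 hδ1 hβ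
      hc0 hM0 hc1 hc2 hG hκ3
    refine ⟨D, hD0, fun z hz => ?_⟩
    exact hD z.1 z.2 (U_sub hz).1 (U_sub hz).2
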